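/- Let D = ker α∧β be an Engel structure, g a Riemannian metric with D^⊥ = R (the Reeb distribution), and fix a framing D = ⟨W, X⟩ which is g-orthonormal and such that W spans the characteristic foliation. Then D is totally geodesic if and only if the following bracket relations hold: [W,T] = b_WT X; [W,R] = b_WR X + d_WR R; [X,T] = −b_WT W + d_XT R; [X,R] = −b_WR W + d_XR R. -/

import Mathlib

noncomputable section

open Manifold Module Function Set

variable {E : Type*} [NormedAddCommGroup E] [NormedSpace ℝ E]
  {H : Type*} [TopologicalSpace H]

/-- The type of (not necessarily smooth) vector fields on a manifold. -/
abbrev VF (I : ModelWithCorners ℝ E H) (M : Type*) [TopologicalSpace M] [ChartedSpace H M] :=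
  ∀ x : M, TangentSpace I x

/-- A vector field is smooth if the corresponding section of the tangent bundle is smooth. -/
def SmoothVF (I : ModelWithCorners ℝ E H) {M : Type*} [TopologicalSpace M] [ChartedSpace H M]
    [IsManifold I (⊤ : ℕ∞) M] (V : VF I M) : Prop :=
  ContMDiff I I.tangent (⊤ : ℕ∞) (fun x => (⟨x, V x⟩ : TangentBundle I M))

/-- A smooth real valued function on a manifold. -/
def SmoothFn (I : ModelWithCorners ℝ E H) {M : Type*} [TopologicalSpace M] [ChartedSpace H M]
    [IsManifold I (⊤ : ℕ∞) M] (f : M → ℝ) : Prop :=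
  ContMDiff I 𝓘(ℝ) (⊤ : ℕ∞) f

/-- Derivative of a real valued function along a vector field. -/
def vderiv (I : ModelWithCorners ℝ E H) {M : Type*} [TopologicalSpace M] [ChartedSpace H M]
    [IsManifold I (⊤ : ℕ∞) M] (V : VF I M) (f : M → ℝ) : M → ℝ :=
  fun x => mfderiv I 𝓘(ℝ) f x (V x)

/-- The Lie bracket of two vector fields on a manifold, defined by transporting the two
vector fields to the model space via the preferred chart at the given point, taking the
Lie bracket of vector fields there, and transporting the result back.  For smooth vector
fields this is the usual Lie bracket `[V, W]`. -/
def vfLie (I : ModelWithCorners ℝ E H) {M : Type*} [TopologicalSpace M] [ChartedSpace H M]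
    [IsManifold I (⊤ : ℕ∞) M] (V W : VF I M) : VF I M := fun x₀ =>
  mfderiv 𝓘(ℝ, E) I (extChartAt I x₀).symm (extChartAt I x₀ x₀)
    ((VectorField.lieBracket ℝ
      (fun e => (mfderiv I 𝓘(ℝ, E) (extChartAt I x₀) ((extChartAt I x₀).symm e)
        (V ((extChartAt I x₀).symm e)) : E))
      (fun e => (mfderiv I 𝓘(ℝ, E) (extChartAt I x₀) ((extChartAt I x₀).symm e)
        (W ((extChartAt I x₀).symm e)) : E))
      (extChartAt I x₀ x₀) : E))

/-- A smooth differential `1`-form on a manifold, given by its pointwise values. -/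
structure OneForm (I : ModelWithCorners ℝ E H) (M : Type*) [TopologicalSpace M]
    [ChartedSpace H M] [IsManifold I (⊤ : ℕ∞) M] where
  val : ∀ x : M, TangentSpace I x →ₗ[ℝ] ℝ
  smooth' : ∀ V : VF I M, SmoothVF I V → SmoothFn I (fun x => val x (V x))

/-- A smooth differential `k`-form on a manifold, given by its pointwise values. -/
structure FormPt (I : ModelWithCorners ℝ E H) (M : Type*) [TopologicalSpace M]
    [ChartedSpace H M] [IsManifold I (⊤ : ℕ∞) M] (k : ℕ) where
  val : ∀ x : M, (TangentSpace I x) [⋀^Fin k]→ₗ[ℝ] ℝ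
  smooth' : ∀ V : Fin k → VF I M, (∀ i, SmoothVF I (V i)) →
    SmoothFn I (fun x => val x (fun i => V i x))

variable {I : ModelWithCorners ℝ E H} {M : Type*} [TopologicalSpace M] [ChartedSpace H M]
  [IsManifold I (⊤ : ℕ∞) M]

/-- The exterior derivative of a (pointwise defined) `1`-form, evaluated on two vector
fields, via the Cartan formula `dω(V,W) = V (ω W) - W (ω V) - ω [V,W]`.  Here the `1`-form
is given as a function on vector fields. -/
def dOfFun (I : ModelWithCorners ℝ E H) {M : Type*} [TopologicalSpace M] [ChartedSpace H M]
    [IsManifold I (⊤ : ℕ∞) M] (lam : VF I M → M → ℝ) (V W : VF I M) : M → ℝ :=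
  fun x => vderiv I V (lam W) x - vderiv I W (lam V) x - lam (vfLie I V W) x

/-- The exterior derivative of a `1`-form, as a function of two vector fields. -/
def OneForm.d (ω : OneForm I M) (V W : VF I M) : M → ℝ :=
  dOfFun I (fun U x => ω.val x (U x)) V W

/-- A distribution (field of tangent subspaces) on a manifold. -/
abbrev TangentDist (I : ModelWithCorners ℝ E H) (M : Type*) [TopologicalSpace M] [ChartedSpace H M] :=
  ∀ x : M, Submodule ℝ (TangentSpace I x)

/-- A (smooth) section of a distribution. -/
def IsSection (I : ModelWithCorners ℝ E H) {M : Type*} [TopologicalSpace M] [ChartedSpace H M]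
    [IsManifold I (⊤ : ℕ∞) M] (D : TangentDist I M) (V : VF I M) : Prop :=
  SmoothVF I V ∧ ∀ x, V x ∈ D x

/-- The distribution `[D, D]` generated by a distribution `D` together with all Lie brackets
of its sections. -/
def derivedDist (I : ModelWithCorners ℝ E H) {M : Type*} [TopologicalSpace M] [ChartedSpace H M]
    [IsManifold I (⊤ : ℕ∞) M] (D : TangentDist I M) : TangentDist I M := fun x =>
  Submodule.span ℝ
    ({v | ∃ V, IsSection I D V ∧ V x = v} ∪
     {v | ∃ V W, IsSection I D V ∧ IsSection I D W ∧ vfLie I V W x = v})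

/-- A distribution is integrable (in the sense of Frobenius: involutive) if Lie brackets of
its sections are again tangent to it. -/
def IsIntegrableDist (I : ModelWithCorners ℝ E H) {M : Type*} [TopologicalSpace M]
    [ChartedSpace H M] [IsManifold I (⊤ : ℕ∞) M] (D : TangentDist I M) : Prop :=
  ∀ V W, IsSection I D V → IsSection I D W → ∀ x, vfLie I V W x ∈ D x

/-- `(ω ∧ θ)(U,V,W)` for a `1`-form `ω` and a `2`-form `θ` given as a function of two
vector fields. -/
def wedge1_2 (I : ModelWithCorners ℝ E H) {M : Type*} [TopologicalSpace M] [ChartedSpace H M]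
    [IsManifold I (⊤ : ℕ∞) M] (ω : OneForm I M) (θ : VF I M → VF I M → M → ℝ)
    (U V W : VF I M) : M → ℝ := fun x =>
  ω.val x (U x) * θ V W x - ω.val x (V x) * θ U W x + ω.val x (W x) * θ U V x

/-- The square `θ ∧ θ` of a `2`-form `θ` (given as a function of two vector fields) vanishes
identically. -/
def FormSqZero (I : ModelWithCorners ℝ E H) {M : Type*} [TopologicalSpace M] [ChartedSpace H M]
    [IsManifold I (⊤ : ℕ∞) M] (θ : VF I M → VF I M → M → ℝ) : Prop :=
  ∀ V₀ V₁ V₂ V₃ : VF I M, SmoothVF I V₀ → SmoothVF I V₁ → SmoothVF I V₂ → SmoothVF I V₃ →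
    ∀ x, θ V₀ V₁ x * θ V₂ V₃ x - θ V₀ V₂ x * θ V₁ V₃ x + θ V₀ V₃ x * θ V₁ V₂ x = 0

/-- An Engel structure: a rank 2 distribution `D` such that `E := [D,D]` has rank 3 and
`[E,E] = TM`. -/
def IsEngel (I : ModelWithCorners ℝ E H) {M : Type*} [TopologicalSpace M] [ChartedSpace H M]
    [IsManifold I (⊤ : ℕ∞) M] (D : TangentDist I M) : Prop :=
  (∀ x, Module.finrank ℝ (D x) = 2) ∧ (∀ x, Module.finrank ℝ (derivedDist I D x) = 3) ∧
  (∀ x, derivedDist I (derivedDist I D) x = ⊤)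

/-- Engel defining forms: `D = ker α ∩ ker β` and `E = [D,D] = ker α`. -/
def EngelDefiningForms (I : ModelWithCorners ℝ E H) {M : Type*} [TopologicalSpace M]
    [ChartedSpace H M] [IsManifold I (⊤ : ℕ∞) M] (D : TangentDist I M)
    (α β : OneForm I M) : Prop :=
  (∀ x, D x = LinearMap.ker (α.val x) ⊓ LinearMap.ker (β.val x)) ∧
  (∀ x, derivedDist I D x = LinearMap.ker (α.val x))

/-- The pair of Reeb vector fields `T`, `R` associated with Engel defining forms `α`, `β`:
`i_T(α ∧ dβ) = 0`, `β(T) = 1`, `α(T) = 0`, `i_R(β ∧ dβ) = 0`, `β(R) = 0`, `α(R) = 1`. -/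
structure IsReebPair (I : ModelWithCorners ℝ E H) {M : Type*} [TopologicalSpace M]
    [ChartedSpace H M] [IsManifold I (⊤ : ℕ∞) M] (α β : OneForm I M)
    (T R : VF I M) : Prop where
  smoothT : SmoothVF I T
  smoothR : SmoothVF I R
  alphaT : ∀ x, α.val x (T x) = 0
  betaT : ∀ x, β.val x (T x) = 1
  alphaR : ∀ x, α.val x (R x) = 1
  betaR : ∀ x, β.val x (R x) = 0
  insT : ∀ V W, SmoothVF I V → SmoothVF I W → ∀ x, wedge1_2 I α β.d T V W x = 0
  insR : ∀ V W, SmoothVF I V → SmoothVF I W → ∀ x, wedge1_2 I β β.d R V W x = 0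

/-- The Reeb distribution spanned by the two Reeb vector fields. -/
def reebDist (I : ModelWithCorners ℝ E H) {M : Type*} [TopologicalSpace M] [ChartedSpace H M]
    (T R : VF I M) : TangentDist I M := fun x => Submodule.span ℝ {T x, R x}

/-- `W` is a nonsingular vector field spanning the characteristic foliation of the even
contact structure `E = [D,D]`:  `W` is tangent to `D` and `[W, E] ⊆ E`. -/
def SpansChar (I : ModelWithCorners ℝ E H) {M : Type*} [TopologicalSpace M] [ChartedSpace H M]
    [IsManifold I (⊤ : ℕ∞) M] (D : TangentDist I M) (W : VF I M) : Prop :=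
  SmoothVF I W ∧ (∀ x, W x ≠ 0) ∧ (∀ x, W x ∈ D x) ∧
  ∀ V, IsSection I (derivedDist I D) V → ∀ x, vfLie I W V x ∈ derivedDist I D x

/-- A Riemannian metric, given by its pointwise values. -/
structure RMetric (I : ModelWithCorners ℝ E H) (M : Type*) [TopologicalSpace M]
    [ChartedSpace H M] [IsManifold I (⊤ : ℕ∞) M] where
  val : ∀ x : M, TangentSpace I x →ₗ[ℝ] TangentSpace I x →ₗ[ℝ] ℝ
  symm : ∀ x u v, val x u v = val x v u
  posdef : ∀ x v, v ≠ 0 → 0 < val x v v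
  smooth' : ∀ V W, SmoothVF I V → SmoothVF I W → SmoothFn I (fun x => val x (V x) (W x))

/-- The Koszul formula: `koszul g X Y Z = g(∇_X Y, Z)` where `∇` is the Levi-Civita
connection of `g`. -/
def koszul (I : ModelWithCorners ℝ E H) {M : Type*} [TopologicalSpace M] [ChartedSpace H M]
    [IsManifold I (⊤ : ℕ∞) M] (g : RMetric I M) (X Y Z : VF I M) : M → ℝ := fun x =>
  (vderiv I X (fun y => g.val y (Y y) (Z y)) x + vderiv I Y (fun y => g.val y (X y) (Z y)) x
    - vderiv I Z (fun y => g.val y (X y) (Y y)) x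
    + g.val x (vfLie I X Y x) (Z x) - g.val x (vfLie I X Z x) (Y x)
    - g.val x (vfLie I Y Z x) (X x)) / 2

/-- A distribution `D` is totally geodesic for `g` iff every geodesic tangent to it at one
point stays tangent to it; equivalently (the standard characterization, which we take as the
definition) `∇_U U` is tangent to `D` for every section `U` of `D`, i.e. `g(∇_U U, V) = 0`
for every vector field `V` orthogonal to `D`. -/
def IsTotallyGeodesic (I : ModelWithCorners ℝ E H) {M : Type*} [TopologicalSpace M]
    [ChartedSpace H M] [IsManifold I (⊤ : ℕ∞) M] (g : RMetric I M)
    (D : TangentDist I M) : Prop :=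
  ∀ U, IsSection I D U → ∀ V, SmoothVF I V → (∀ x, ∀ u ∈ D x, g.val x (V x) u = 0) →
    ∀ x, koszul I g U U V x = 0

/-- A Killing vector field: `L_Z g = 0`, expressed on vector fields. -/
def IsKilling (I : ModelWithCorners ℝ E H) {M : Type*} [TopologicalSpace M] [ChartedSpace H M]
    [IsManifold I (⊤ : ℕ∞) M] (g : RMetric I M) (Z : VF I M) : Prop :=
  ∀ V W, SmoothVF I V → SmoothVF I W → ∀ x,
    vderiv I Z (fun y => g.val y (V y) (W y)) x
      = g.val x (vfLie I Z V x) (W x) + g.val x (V x) (vfLie I Z W x)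

/-- An Engel vector field: the flow of `Z` preserves `D`, i.e. `L_Z D ⊆ D`. -/
def IsEngelVF (I : ModelWithCorners ℝ E H) {M : Type*} [TopologicalSpace M] [ChartedSpace H M]
    [IsManifold I (⊤ : ℕ∞) M] (D : TangentDist I M) (Z : VF I M) : Prop :=
  SmoothVF I Z ∧ ∀ V, IsSection I D V → ∀ x, vfLie I Z V x ∈ D x

/-- A K-Engel structure: `D` is an Engel structure, `g` a Riemannian metric and `Z` a
(nowhere vanishing) vector field which is Engel, Killing and orthogonal to `E = [D,D]`. -/
structure IsKEngel (I : ModelWithCorners ℝ E H) {M : Type*} [TopologicalSpace M]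
    [ChartedSpace H M] [IsManifold I (⊤ : ℕ∞) M] (D : TangentDist I M)
    (g : RMetric I M) (Z : VF I M) : Prop where
  engel : IsEngel I D
  engelVF : IsEngelVF I D Z
  killing : IsKilling I g Z
  orth : ∀ x, ∀ v ∈ derivedDist I D x, g.val x (Z x) v = 0
  nonzero : ∀ x, Z x ≠ 0

/-- A `1`-form is closed. -/
def OneForm.IsClosed {I : ModelWithCorners ℝ E H} {M : Type*} [TopologicalSpace M]
    [ChartedSpace H M] [IsManifold I (⊤ : ℕ∞) M] (ω : OneForm I M) : Prop :=
  ∀ V W, SmoothVF I V → SmoothVF I W → ∀ x, ω.d V W x = 0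

/-- The Lie derivative `(L_Z ω)(V) = Z (ω V) - ω [Z,V]` of a `1`-form along a vector
field, as a function of vector fields. -/
def lieOneForm (I : ModelWithCorners ℝ E H) {M : Type*} [TopologicalSpace M] [ChartedSpace H M]
    [IsManifold I (⊤ : ℕ∞) M] (ω : OneForm I M) (Z V : VF I M) : M → ℝ := fun x =>
  vderiv I Z (fun y => ω.val y (V y)) x - ω.val x (vfLie I Z V x)

/-- The exterior derivative of a pointwise-defined `(m+1)`-form evaluated on `m+2` vector
fields, via the global Koszul formula. -/
def extDerEval (I : ModelWithCorners ℝ E H) {M : Type*} [TopologicalSpace M] [ChartedSpace H M]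
    [IsManifold I (⊤ : ℕ∞) M] {m : ℕ} (ν : FormPt I M (m+1)) (V : Fin (m+2) → VF I M) :
    M → ℝ := fun x =>
  (∑ i : Fin (m+2), (-1 : ℝ)^(i : ℕ) *
    vderiv I (V i) (fun y => ν.val y (fun l => V (i.succAbove l) y)) x)
  + ∑ i : Fin (m+2), ∑ j : Fin (m+2), if h : (i : ℕ) < (j : ℕ) then
      (-1 : ℝ)^((i : ℕ)+(j : ℕ)) * ν.val x (Fin.cons (vfLie I (V i) (V j) x)
        (fun l => V (j.succAbove ((⟨(i : ℕ), by have := j.2; omega⟩ : Fin (m+1)).succAbove l)) x))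
    else 0

/-- A pointwise-defined form is closed. -/
def FormPt.IsClosedForm {I : ModelWithCorners ℝ E H} {M : Type*} [TopologicalSpace M]
    [ChartedSpace H M] [IsManifold I (⊤ : ℕ∞) M] {m : ℕ} (ν : FormPt I M (m+1)) : Prop :=
  ∀ V : Fin (m+2) → VF I M, (∀ i, SmoothVF I (V i)) → ∀ x, extDerEval I ν V x = 0

/-- `φ : ℝ → M → M` is the flow of the vector field `Z`. -/
def IsFlowOf (I : ModelWithCorners ℝ E H) {M : Type*} [TopologicalSpace M] [ChartedSpace H M]
    [IsManifold I (⊤ : ℕ∞) M] (Z : VF I M) (φ : ℝ → M → M) : Prop :=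
  Continuous (fun p : ℝ × M => φ p.1 p.2) ∧ (∀ x, φ 0 x = x) ∧
  (∀ s t x, φ (s + t) x = φ s (φ t x)) ∧
  ∀ x t, HasMFDerivAt 𝓘(ℝ) I (fun s => φ s x) t
    ((1 : ℝ →L[ℝ] ℝ).smulRight (Z (φ t x)))

/-- `(η ∧ dη ∧ dη)(V₀,...,V₄)` up to a positive constant factor, for a pointwise `1`-form
`η`; pointwise nonvanishing of this expression on frames is the contact condition in
dimension 5. -/
def contactEval (I : ModelWithCorners ℝ E H) {M : Type*} [TopologicalSpace M] [ChartedSpace H M]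
    [IsManifold I (⊤ : ℕ∞) M] (η : ∀ z : M, TangentSpace I z →ₗ[ℝ] ℝ)
    (V : Fin 5 → VF I M) : M → ℝ := fun z =>
  ∑ σ : Equiv.Perm (Fin 5), ((Equiv.Perm.sign σ : ℤ) : ℝ) *
    (η z (V (σ 0) z) * dOfFun I (fun U x => η x (U x)) (V (σ 1)) (V (σ 2)) z *
      dOfFun I (fun U x => η x (U x)) (V (σ 3)) (V (σ 4)) z)

section Helpers

variable {J : ModelWithCorners ℝ E H} {N : Type*} [TopologicalSpace N] [ChartedSpace H N]
  [IsManifold J (⊤ : ℕ∞) N]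

/-- Over a boundaryless model, `vfLie` is Mathlib's Lie bracket of vector fields. -/
lemma vfLie_eq_mlieBracket [J.Boundaryless] (V W : VF J N) :
    vfLie J V W = VectorField.mlieBracket J V W := by
  funext x₀
  have key : ∀ V : VF J N,
      (fun e => (mfderiv J 𝓘(ℝ, E) (extChartAt J x₀) ((extChartAt J x₀).symm e)
        (V ((extChartAt J x₀).symm e)) : E)) =ᶠ[nhds (extChartAt J x₀ x₀)]
      (VectorField.mpullbackWithin 𝓘(ℝ, E) J (extChartAt J x₀).symm V (range J)) := by
    intro V
    filter_upwards [extChartAt_target_mem_nhds (I := J) x₀] with e he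
    have hcomp := mfderivWithin_extChartAt_symm_comp_mfderiv_extChartAt (I := J) he
    refine Eq.symm ((ContinuousLinearMap.IsInvertible.inverse_apply_eq
      (isInvertible_mfderivWithin_extChartAt_symm he)).2 ?_)
    exact (DFunLike.congr_fun hcomp (V ((extChartAt J x₀).symm e))).symm
  have hid : mfderiv 𝓘(ℝ, E) J (extChartAt J x₀).symm (extChartAt J x₀ x₀)
      = ContinuousLinearMap.id ℝ E := by
    rw [← mfderivWithin_univ, ← J.range_eq_univ]
    exact mfderivWithin_range_extChartAt_symm
  have hinv : (mfderiv J 𝓘(ℝ, E) (extChartAt J x₀) x₀).inverse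
      = ContinuousLinearMap.id ℝ E := by
    rw [mfderiv_extChartAt_self]
    exact ContinuousLinearMap.inverse_id
  have hset : (extChartAt J x₀).symm ⁻¹' (univ : Set N) ∩ range J = univ := by
    rw [preimage_univ, univ_inter, J.range_eq_univ]
  rw [← VectorField.mlieBracketWithin_univ, VectorField.mlieBracketWithin_apply, hset, vfLie,
    hid, hinv]
  have hbr := (key V).lieBracket_vectorField_eq (𝕜 := ℝ) (key W)
  exact hbr.trans (congr_fun VectorField.lieBracketWithin_univ _).symm

lemma vfLie_swap [J.Boundaryless] (V W : VF J N) (x : N) :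
    vfLie J V W x = - vfLie J W V x := by
  simp only [vfLie_eq_mlieBracket]
  exact VectorField.mlieBracket_swap_apply

lemma SmoothVF.mdifferentiableAt {V : VF J N} (hV : SmoothVF J V) (x : N) :
    MDifferentiableAt J J.tangent (fun y => (⟨y, V y⟩ : TangentBundle J N)) x :=
  (ContMDiff.contMDiffAt hV).mdifferentiableAt (by simp)

lemma SmoothFn.mdifferentiableAt {f : N → ℝ} (hf : SmoothFn J f) (x : N) :
    MDifferentiableAt J 𝓘(ℝ) f x :=
  (ContMDiff.contMDiffAt hf).mdifferentiableAt (by simp)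

lemma SmoothVF.add {V W : VF J N} (hV : SmoothVF J V) (hW : SmoothVF J W) :
    SmoothVF J (V + W) :=
  ContMDiff.add_section hV hW

lemma SmoothVF.smul {f : N → ℝ} {V : VF J N} (hf : SmoothFn J f) (hV : SmoothVF J V) :
    SmoothVF J (f • V) :=
  ContMDiff.smul_section hf hV

lemma SmoothFn.const (c : ℝ) : SmoothFn J (fun _ : N => c) :=
  contMDiff_const

lemma vderiv_const (V : VF J N) (c : ℝ) (x : N) : vderiv J V (fun _ => c) x = 0 := by
  rw [vderiv, mfderiv_const]
  rfl

lemma vderiv_add_mul_self {f h : N → ℝ} (hf : SmoothFn J f) (hh : SmoothFn J h)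
    (V : VF J N) (x : N) :
    vderiv J V (fun y => f y * f y + h y * h y) x
      = 2 * (f x * vderiv J V f x + h x * vderiv J V h x) := by
  have hf' := hf.mdifferentiableAt x
  have hh' := hh.mdifferentiableAt x
  have h1 := mvfderiv_add (hf'.mul hf') (hh'.mul hh')
  rw [mvfderiv_mul hf' hf', mvfderiv_mul hh' hh'] at h1
  have h2 := DFunLike.congr_fun h1 (V x)
  have h3 : vderiv J V (fun y => f y * f y + h y * h y) x
      = f x * vderiv J V f x + f x * vderiv J V f x
        + (h x * vderiv J V h x + h x * vderiv J V h x) := h2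
  rw [h3]
  ring

lemma vfLie_combination_left [J.Boundaryless] [CompleteSpace E] {f h : N → ℝ} {W X : VF J N}
    (hf : SmoothFn J f)
    (hh : SmoothFn J h) (hW : SmoothVF J W) (hX : SmoothVF J X) (V : VF J N) (x : N) :
    vfLie J (f • W + h • X) V x
      = f x • vfLie J W V x + h x • vfLie J X V x
        - (vderiv J V f x • W x + vderiv J V h x • X x) := by
  simp only [vfLie_eq_mlieBracket]
  rw [VectorField.mlieBracket_add_left ((SmoothVF.smul hf hW).mdifferentiableAt x)
      ((SmoothVF.smul hh hX).mdifferentiableAt x),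
    VectorField.mlieBracket_smul_left (hf.mdifferentiableAt x) (hW.mdifferentiableAt x),
    VectorField.mlieBracket_smul_left (hh.mdifferentiableAt x) (hX.mdifferentiableAt x)]
  change -(vderiv J V f x) • W x + _ + (-(vderiv J V h x) • X x + _) = _
  module

lemma vfLie_combination_right [J.Boundaryless] [CompleteSpace E] {p q : N → ℝ} {T R : VF J N}
    (hp : SmoothFn J p)
    (hq : SmoothFn J q) (hT : SmoothVF J T) (hR : SmoothVF J R) (V : VF J N) (x : N) :
    vfLie J V (p • T + q • R) x
      = p x • vfLie J V T x + q x • vfLie J V R x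
        + (vderiv J V p x • T x + vderiv J V q x • R x) := by
  rw [vfLie_swap, vfLie_combination_left hp hq hT hR, vfLie_swap V T, vfLie_swap V R]
  module

/-- The normal part of `∇_U U` for `U = f W + h X` and a normal field `V = p T + q R`. -/
lemma koszul_combination [J.Boundaryless] [CompleteSpace E] (g : RMetric J N)
    {W X T R : VF J N} (hW : SmoothVF J W) (hX : SmoothVF J X) (hT : SmoothVF J T)
    (hR : SmoothVF J R)
    (hWW : ∀ x, g.val x (W x) (W x) = 1) (hXX : ∀ x, g.val x (X x) (X x) = 1)
    (hWX : ∀ x, g.val x (W x) (X x) = 0)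
    (hTW : ∀ x, g.val x (T x) (W x) = 0) (hTX : ∀ x, g.val x (T x) (X x) = 0)
    (hRW : ∀ x, g.val x (R x) (W x) = 0) (hRX : ∀ x, g.val x (R x) (X x) = 0)
    {f h p q : N → ℝ} (hf : SmoothFn J f) (hh : SmoothFn J h) (hp : SmoothFn J p)
    (hq : SmoothFn J q) (x : N) :
    koszul J g (f • W + h • X) (f • W + h • X) (p • T + q • R) x
      = -(p x * (f x ^ 2 * g.val x (vfLie J W T x) (W x)
            + f x * h x * (g.val x (vfLie J W T x) (X x) + g.val x (vfLie J X T x) (W x))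
            + h x ^ 2 * g.val x (vfLie J X T x) (X x))
        + q x * (f x ^ 2 * g.val x (vfLie J W R x) (W x)
            + f x * h x * (g.val x (vfLie J W R x) (X x) + g.val x (vfLie J X R x) (W x))
            + h x ^ 2 * g.val x (vfLie J X R x) (X x))) := by
  have hXW : ∀ x, g.val x (X x) (W x) = 0 := fun x => by rw [g.symm, hWX]
  have hWT : ∀ x, g.val x (W x) (T x) = 0 := fun x => by rw [g.symm, hTW]
  have hXT : ∀ x, g.val x (X x) (T x) = 0 := fun x => by rw [g.symm, hTX]
  have hWR : ∀ x, g.val x (W x) (R x) = 0 := fun x => by rw [g.symm, hRW]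
  have hXR : ∀ x, g.val x (X x) (R x) = 0 := fun x => by rw [g.symm, hRX]
  have hUV : (fun y => g.val y ((f • W + h • X) y) ((p • T + q • R) y)) = fun _ => 0 := by
    funext y
    simp [hWT, hXT, hWR, hXR]
  have hUU : (fun y => g.val y ((f • W + h • X) y) ((f • W + h • X) y))
      = fun y => f y * f y + h y * h y := by
    funext y
    simp [hWW, hXX, hWX, hXW]
  have hself : vfLie J (f • W + h • X) (f • W + h • X) x = 0 := by
    rw [vfLie_eq_mlieBracket, VectorField.mlieBracket_self]
    rfl
  rw [koszul, hUV, hUU, hself, vderiv_const, vderiv_add_mul_self hf hh,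
    vfLie_combination_left hf hh hW hX, vfLie_combination_right hp hq hT hR,
    vfLie_combination_right hp hq hT hR]
  simp [hWW, hXX, hWX, hXW, hTW, hTX, hRW, hRX]
  ring

end Helpers

/-- With `D = ker α∧β` Engel, `g` a metric with `D ⊥ = 𝓡`, and an
orthonormal framing `D = ⟨W, X⟩` with `W` spanning the characteristic foliation, `D` is
totally geodesic if and only if the brackets have the form `[W,T] = b_WT X`,
`[W,R] = b_WR X + d_WR R`, `[X,T] = −b_WT W + d_XT R`, `[X,R] = −b_WR W + d_XR R`. -/
theorem totally_geodesic_iff_bracket_relations {M : Type*} [TopologicalSpace M]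
    [ChartedSpace (EuclideanSpace ℝ (Fin 4)) M] [IsManifold (𝓡 4) (⊤ : ℕ∞) M]
    (D : TangentDist (𝓡 4) M) (α β : OneForm (𝓡 4) M)
    (hD : IsEngel (𝓡 4) D) (hforms : EngelDefiningForms (𝓡 4) D α β)
    (T R : VF (𝓡 4) M) (hTR : IsReebPair (𝓡 4) α β T R)
    (W X : VF (𝓡 4) M) (hWchar : SpansChar (𝓡 4) D W) (hXs : SmoothVF (𝓡 4) X)
    (hspan : ∀ x, D x = Submodule.span ℝ {W x, X x})
    (hbasis : ∀ x, LinearIndependent ℝ ![W x, X x, T x, R x])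
    (g : RMetric (𝓡 4) M)
    -- `{W, X}` is `g`-orthonormal
    (hWW : ∀ x, g.val x (W x) (W x) = 1) (hXX : ∀ x, g.val x (X x) (X x) = 1)
    (hWX : ∀ x, g.val x (W x) (X x) = 0)
    -- `D ⊥ = 𝓡`
    (hperp : ∀ x v, v ∈ reebDist (𝓡 4) T R x ↔ ∀ u ∈ D x, g.val x v u = 0) :
    IsTotallyGeodesic (𝓡 4) g D ↔
      ∃ bWT bWR dWR dXT dXR : M → ℝ,
        (∀ x, vfLie (𝓡 4) W T x = bWT x • X x) ∧
        (∀ x, vfLie (𝓡 4) W R x = bWR x • X x + dWR x • R x) ∧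
        (∀ x, vfLie (𝓡 4) X T x = -(bWT x) • W x + dXT x • R x) ∧
        (∀ x, vfLie (𝓡 4) X R x = -(bWR x) • W x + dXR x • R x) := by
  have hW := hWchar.1
  have hT := hTR.smoothT
  have hR := hTR.smoothR
  have hWD : ∀ x, W x ∈ D x := hWchar.2.2.1
  have hXD : ∀ x, X x ∈ D x := fun x => by
    rw [hspan]
    exact Submodule.subset_span (by simp)
  have hker : ∀ x v, v ∈ D x ↔ α.val x v = 0 ∧ β.val x v = 0 := fun x v => by
    rw [hforms.1 x]
    simp
  have hTperp : ∀ x, ∀ u ∈ D x, g.val x (T x) u = 0 := fun x =>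
    (hperp x _).1 (Submodule.subset_span (by simp))
  have hRperp : ∀ x, ∀ u ∈ D x, g.val x (R x) u = 0 := fun x =>
    (hperp x _).1 (Submodule.subset_span (by simp))
  have hXW : ∀ x, g.val x (X x) (W x) = 0 := fun x => by rw [g.symm, hWX]
  have hdecD : ∀ x, ∀ v ∈ D x, v = g.val x v (W x) • W x + g.val x v (X x) • X x := by
    intro x v hv
    rw [hspan, Submodule.mem_span_pair] at hv
    obtain ⟨a, b, rfl⟩ := hv
    simp [hWW, hXX, hWX, hXW]
  -- the Reeb conditions kill the `T`-components of all brackets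
  have hdT : ∀ A : VF (𝓡 4) M, SmoothVF (𝓡 4) A → (∀ x, A x ∈ D x) →
      ∀ x, β.val x (vfLie (𝓡 4) A T x) = 0 := by
    intro A hA hAD x
    have hins := hTR.insT R A hR hA x
    have hβA : (fun y => β.val y (A y)) = fun _ => 0 := funext fun y => ((hker y _).1 (hAD y)).2
    have hβT : (fun y => β.val y (T y)) = fun _ => 1 := funext hTR.betaT
    simp only [wedge1_2, hTR.alphaT, hTR.alphaR, ((hker x _).1 (hAD x)).1, OneForm.d, dOfFun,
      hβA, hβT, vderiv_const] at hins
    rw [vfLie_swap, map_neg]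
    linarith
  have hdR : ∀ A : VF (𝓡 4) M, SmoothVF (𝓡 4) A → (∀ x, A x ∈ D x) →
      ∀ x, β.val x (vfLie (𝓡 4) A R x) = 0 := by
    intro A hA hAD x
    have hins := hTR.insR T A hT hA x
    have hβA : (fun y => β.val y (A y)) = fun _ => 0 := funext fun y => ((hker y _).1 (hAD y)).2
    simp only [wedge1_2, hTR.betaT, hTR.betaR, ((hker x _).1 (hAD x)).2, OneForm.d, dOfFun,
      hβA, vderiv_const] at hins
    rw [vfLie_swap, map_neg]
    linarith
  have hαWT : ∀ x, α.val x (vfLie (𝓡 4) W T x) = 0 := by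
    intro x
    have hmem := hWchar.2.2.2 T ⟨hT, fun y => by rw [hforms.2]; exact hTR.alphaT y⟩ x
    rw [hforms.2] at hmem
    exact hmem
  have hdec : ∀ x v, β.val x v = 0 →
      v = g.val x v (W x) • W x + g.val x v (X x) • X x + α.val x v • R x := by
    intro x v hv
    have hmem : v - α.val x v • R x ∈ D x := by
      rw [hker]
      simp [hTR.alphaR, hTR.betaR, hv]
    have heq := hdecD x _ hmem
    simp only [map_sub, map_smul, LinearMap.sub_apply, LinearMap.smul_apply,
      hRperp x _ (hWD x), hRperp x _ (hXD x), smul_zero, sub_zero] at heq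
    rwa [sub_eq_iff_eq_add] at heq
  have hkos : ∀ {f h p q : M → ℝ}, SmoothFn (𝓡 4) f → SmoothFn (𝓡 4) h → SmoothFn (𝓡 4) p →
      SmoothFn (𝓡 4) q → ∀ x, _ := fun hf hh hp hq x =>
    koszul_combination g hW hXs hT hR hWW hXX hWX (fun x => hTperp x _ (hWD x))
      (fun x => hTperp x _ (hXD x)) (fun x => hRperp x _ (hWD x)) (fun x => hRperp x _ (hXD x))
      hf hh hp hq x
  constructor
  · intro htg
    have hconst : ∀ a b c d : ℝ, ∀ x,
        c * (a ^ 2 * g.val x (vfLie (𝓡 4) W T x) (W x)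
            + a * b * (g.val x (vfLie (𝓡 4) W T x) (X x) + g.val x (vfLie (𝓡 4) X T x) (W x))
            + b ^ 2 * g.val x (vfLie (𝓡 4) X T x) (X x))
        + d * (a ^ 2 * g.val x (vfLie (𝓡 4) W R x) (W x)
            + a * b * (g.val x (vfLie (𝓡 4) W R x) (X x) + g.val x (vfLie (𝓡 4) X R x) (W x))
            + b ^ 2 * g.val x (vfLie (𝓡 4) X R x) (X x)) = 0 := by
      intro a b c d x
      have ha := SmoothFn.const (J := 𝓡 4) (N := M) a
      have hb := SmoothFn.const (J := 𝓡 4) (N := M) b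
      have hc := SmoothFn.const (J := 𝓡 4) (N := M) c
      have hd := SmoothFn.const (J := 𝓡 4) (N := M) d
      have h0 := htg _ ⟨(hW.smul ha).add (hXs.smul hb), fun y =>
          (D y).add_mem ((D y).smul_mem _ (hWD y)) ((D y).smul_mem _ (hXD y))⟩
        _ ((hT.smul hc).add (hR.smul hd)) (fun y u hu => by
          simp [hTperp y u hu, hRperp y u hu]) x
      rw [hkos ha hb hc hd x] at h0
      exact neg_eq_zero.1 h0
    refine ⟨fun x => g.val x (vfLie (𝓡 4) W T x) (X x), fun x => g.val x (vfLie (𝓡 4) W R x) (X x),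
      fun x => α.val x (vfLie (𝓡 4) W R x), fun x => α.val x (vfLie (𝓡 4) X T x),
      fun x => α.val x (vfLie (𝓡 4) X R x), fun x => ?_, fun x => ?_, fun x => ?_, fun x => ?_⟩
    · have h1 : g.val x (vfLie (𝓡 4) W T x) (W x) = 0 := by linarith [hconst 1 0 1 0 x]
      have heq := hdec x _ (hdT W hW hWD x)
      rw [h1, hαWT] at heq
      simpa using heq
    · have h1 : g.val x (vfLie (𝓡 4) W R x) (W x) = 0 := by linarith [hconst 1 0 0 1 x]
      have heq := hdec x _ (hdR W hW hWD x)
      rw [h1] at heq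
      simpa using heq
    · have h1 : g.val x (vfLie (𝓡 4) X T x) (X x) = 0 := by linarith [hconst 0 1 1 0 x]
      have h2 : g.val x (vfLie (𝓡 4) X T x) (W x) = -g.val x (vfLie (𝓡 4) W T x) (X x) := by
        linarith [hconst 0 1 1 0 x, hconst 1 0 1 0 x, hconst 1 1 1 0 x]
      have heq := hdec x _ (hdT X hXs hXD x)
      rw [h1, h2] at heq
      simpa using heq
    · have h1 : g.val x (vfLie (𝓡 4) X R x) (X x) = 0 := by linarith [hconst 0 1 0 1 x]
      have h2 : g.val x (vfLie (𝓡 4) X R x) (W x) = -g.val x (vfLie (𝓡 4) W R x) (X x) := by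
        linarith [hconst 0 1 0 1 x, hconst 1 0 0 1 x, hconst 1 1 0 1 x]
      have heq := hdec x _ (hdR X hXs hXD x)
      rw [h1, h2] at heq
      simpa using heq
  · rintro ⟨bWT, bWR, dWR, dXT, dXR, hWT', hWR', hXT', hXR'⟩ U ⟨hU, hUD⟩ V hV hVperp x
    have hUeq : U = (fun y => g.val y (U y) (W y)) • W + (fun y => g.val y (U y) (X y)) • X :=
      funext fun y => hdecD y _ (hUD y)
    have hVeq : V = (fun y => β.val y (V y)) • T + (fun y => α.val y (V y)) • R := by
      funext y
      have hmem := (hperp y _).2 (hVperp y)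
      rw [reebDist, Submodule.mem_span_pair] at hmem
      obtain ⟨a, b, hab⟩ := hmem
      simp only [Pi.add_apply, Pi.smul_apply', ← hab]
      simp [hTR.alphaT, hTR.alphaR, hTR.betaT, hTR.betaR]
    have h0 := hkos (g.smooth' U W hU hW) (g.smooth' U X hU hXs) (β.smooth' V hV)
      (α.smooth' V hV) x
    rw [← hUeq, ← hVeq] at h0
    rw [h0, hWT', hWR', hXT', hXR']
    simp [hWW, hXX, hWX, hXW, hRperp x _ (hWD x), hRperp x _ (hXD x)]
end
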